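/- Identity Principle: Let U ⊆ ℍ be a slice domain and let f : U → ℍ be slice regular. Denote by Z_f = {q ∈ U : f(q) = 0} the zero set of f. If there exists I ∈ 𝕊 such that ℂ_I ∩ Z_f has an accumulation point in U ∩ ℂ_I, then f is identically 0 on U. -/

import Mathlib

open Quaternion
open scoped InnerProductSpace

/-- The sphere `𝕊` of purely imaginary unit quaternions. -/
def QSphere : Set ℍ := {q : ℍ | q ^ 2 = -1}

/-- The complex plane `ℂ_I` through `1` and `I`. -/
def slicePlane (I : ℍ) : Set ℍ := {q : ℍ | ∃ x y : ℝ, q = (x : ℍ) + y • I}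

/-- A real differentiable `f` is (left) slice regular on `U` if on every slice `U ∩ ℂ_I`
it satisfies the Cauchy-Riemann equation `∂f/∂x + I ∂f/∂y = 0`. -/
def SliceRegularOn (f : ℍ → ℍ) (U : Set ℍ) : Prop :=
  DifferentiableOn ℝ f U ∧
    ∀ I ∈ QSphere, ∀ q ∈ U ∩ slicePlane I,
      fderiv ℝ f q 1 + I * fderiv ℝ f q I = 0

/-- A slice domain: a connected open set intersecting the real axis whose
intersection with each complex plane `ℂ_I` is connected. -/
def SliceDomain (U : Set ℍ) : Prop :=
  IsOpen U ∧ IsConnected U ∧ (∃ x : ℝ, (x : ℍ) ∈ U) ∧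
    ∀ I ∈ QSphere, IsPreconnected (U ∩ slicePlane I)

lemma QSphere.mul_self {I : ℍ} (hI : I ∈ QSphere) : I * I = -1 := by
  simpa [QSphere, sq] using hI

/-- Imaginary units have zero real part. -/
lemma QSphere.re_eq_zero {I : ℍ} (hI : I ∈ QSphere) : I.re = 0 := by
  have h := QSphere.mul_self hI
  have h0 := congrArg QuaternionAlgebra.re h
  have h1 := congrArg QuaternionAlgebra.imI h
  have h2 := congrArg QuaternionAlgebra.imJ h
  have h3 := congrArg QuaternionAlgebra.imK h
  simp only [Quaternion.re_mul, Quaternion.imI_mul, Quaternion.imJ_mul, Quaternion.imK_mul,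
    Quaternion.re_neg, Quaternion.imI_neg, Quaternion.imJ_neg, Quaternion.imK_neg,
    Quaternion.re_one, Quaternion.imI_one, Quaternion.imJ_one, Quaternion.imK_one] at h0 h1 h2 h3
  by_contra hre
  have e1 : I.imI = 0 := by
    have : I.re * I.imI = 0 := by linarith
    exact (mul_eq_zero.mp this).resolve_left hre
  have e2 : I.imJ = 0 := by
    have : I.re * I.imJ = 0 := by linarith
    exact (mul_eq_zero.mp this).resolve_left hre
  have e3 : I.imK = 0 := by
    have : I.re * I.imK = 0 := by linarith
    exact (mul_eq_zero.mp this).resolve_left hre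
  rw [e1, e2, e3] at h0
  nlinarith [mul_self_nonneg I.re]

lemma QSphere.inner_self {I : ℍ} (hI : I ∈ QSphere) : ⟪I, I⟫_ℝ = 1 := by
  have h0 := congrArg QuaternionAlgebra.re (QSphere.mul_self hI)
  have hre := QSphere.re_eq_zero hI
  simp only [Quaternion.re_mul, Quaternion.re_neg, Quaternion.re_one] at h0
  rw [Quaternion.inner_def]
  simp only [Quaternion.re_mul, Quaternion.re_star, Quaternion.imI_star, Quaternion.imJ_star,
    Quaternion.imK_star]
  nlinarith

/-- The real-linear parametrization `x + iy ↦ x + Iy` of the plane `ℂ_I`. -/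
noncomputable def sliceMap (I : ℍ) : ℂ →L[ℝ] ℍ :=
  Complex.reCLM.smulRight (1 : ℍ) + Complex.imCLM.smulRight I

lemma sliceMap_apply (I : ℍ) (z : ℂ) : sliceMap I z = z.re • (1 : ℍ) + z.im • I := rfl

lemma sliceMap_eq (I : ℍ) (z : ℂ) : sliceMap I z = (z.re : ℍ) + z.im • I := by
  rw [sliceMap_apply]
  congr 1
  ext <;> simp

lemma sliceMap_ofReal (I : ℍ) (x : ℝ) : sliceMap I x = (x : ℍ) := by
  simp [sliceMap_eq]

lemma sliceMap_mem (I : ℍ) (z : ℂ) : sliceMap I z ∈ slicePlane I :=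
  ⟨z.re, z.im, sliceMap_eq I z⟩

/-- A coordinate map on `ℍ` that inverts `sliceMap I` on `ℂ_I`. -/
noncomputable def sliceCoord (I q : ℍ) : ℂ := ⟨q.re, ⟪I, q⟫_ℝ⟩

lemma continuous_sliceCoord (I : ℍ) : Continuous (sliceCoord I) := by
  have : sliceCoord I = fun q => Complex.equivRealProdCLM.symm (q.re, ⟪I, q⟫_ℝ) := by
    funext q
    apply Complex.ext <;> simp [sliceCoord]
  rw [this]
  exact Complex.equivRealProdCLM.symm.continuous.comp
    (Quaternion.continuous_re.prodMk (continuous_const.inner continuous_id))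

lemma sliceCoord_sliceMap {I : ℍ} (hI : I ∈ QSphere) (z : ℂ) :
    sliceCoord I (sliceMap I z) = z := by
  have hre := QSphere.re_eq_zero hI
  have h1 : ⟪I, (1 : ℍ)⟫_ℝ = 0 := by simp [Quaternion.inner_def, hre]
  apply Complex.ext
  · simp [sliceCoord, sliceMap_apply, hre]
  · simp only [sliceCoord, sliceMap_apply, inner_add_right, inner_smul_right, h1,
      QSphere.inner_self hI]
    simp

lemma sliceMap_sliceCoord {I : ℍ} (hI : I ∈ QSphere) {q : ℍ} (hq : q ∈ slicePlane I) :
    sliceMap I (sliceCoord I q) = q := by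
  obtain ⟨x, y, rfl⟩ := hq
  have : (x : ℍ) + y • I = sliceMap I ⟨x, y⟩ := (sliceMap_eq I ⟨x, y⟩).symm
  rw [this, sliceCoord_sliceMap hI]

lemma exists_mem_slicePlane {I : ℍ} (hI : I ∈ QSphere) (q : ℍ) :
    ∃ J ∈ QSphere, q ∈ slicePlane J := by
  by_cases h : q.im = 0
  · refine ⟨I, hI, q.re, 0, ?_⟩
    conv_lhs => rw [← Quaternion.re_add_im q, h]
    simp
  · have hn : ‖q.im‖ ≠ 0 := norm_ne_zero_iff.mpr h
    refine ⟨‖q.im‖⁻¹ • q.im, ?_, q.re, ‖q.im‖, ?_⟩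
    · have hsq : q.im * q.im = -((‖q.im‖ * ‖q.im‖ : ℝ) : ℍ) := by
        rw [← Quaternion.normSq_eq_norm_mul_self, ← Quaternion.self_mul_star]
        simp
      change (‖q.im‖⁻¹ • q.im) ^ 2 = -1
      rw [sq, smul_mul_smul_comm, hsq, smul_neg, ← Quaternion.coe_smul, smul_eq_mul]
      have : ‖q.im‖⁻¹ * ‖q.im‖⁻¹ * (‖q.im‖ * ‖q.im‖) = 1 := by field_simp
      rw [this, Quaternion.coe_one]
    · rw [smul_inv_smul₀ hn, Quaternion.re_add_im]

/-- The `ℂ`-valued functional `q ↦ ⟪a, q⟫ - i ⟪a, I q⟫`, which turns left multiplication by an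
imaginary unit `I` into multiplication by `i`. -/
noncomputable def sliceFunctional (I a : ℍ) : ℍ →L[ℝ] ℂ :=
  (innerSL ℝ a).smulRight (1 : ℂ) -
    ((innerSL ℝ a).comp (ContinuousLinearMap.mul ℝ ℍ I)).smulRight Complex.I

lemma sliceFunctional_apply (I a q : ℍ) :
    sliceFunctional I a q = (⟪a, q⟫_ℝ : ℂ) - (⟪a, I * q⟫_ℝ : ℂ) * Complex.I := by
  simp [sliceFunctional]

lemma sliceFunctional_re (I a q : ℍ) : (sliceFunctional I a q).re = ⟪a, q⟫_ℝ := by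
  rw [sliceFunctional_apply, Complex.sub_re, Complex.re_ofReal_mul, Complex.I_re, mul_zero,
    sub_zero, Complex.ofReal_re]

lemma sliceFunctional_mul {I : ℍ} (hI : I ∈ QSphere) (a q : ℍ) :
    sliceFunctional I a (I * q) = Complex.I * sliceFunctional I a q := by
  rw [sliceFunctional_apply, sliceFunctional_apply, ← mul_assoc, QSphere.mul_self hI]
  simp only [neg_mul, one_mul, inner_neg_right, Complex.ofReal_neg]
  linear_combination (⟪a, I * q⟫_ℝ : ℂ) * Complex.I_mul_I

/-- Splitting lemma: the components of a slice regular function are holomorphic on slices. -/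
lemma SliceRegularOn.differentiableOn_comp {U : Set ℍ} (hU : IsOpen U) {f : ℍ → ℍ}
    (hf : SliceRegularOn f U) {I : ℍ} (hI : I ∈ QSphere) (a : ℍ) :
    DifferentiableOn ℂ (fun z => sliceFunctional I a (f (sliceMap I z))) (sliceMap I ⁻¹' U) := by
  intro z hz
  have hd : HasFDerivAt f (fderiv ℝ f (sliceMap I z)) (sliceMap I z) :=
    (hf.1.differentiableAt (hU.mem_nhds hz)).hasFDerivAt
  have hcr := hf.2 I hI _ ⟨hz, sliceMap_mem I z⟩
  set D := fderiv ℝ f (sliceMap I z)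
  have hDI : D I = I * D 1 := by
    have h := congrArg (I * ·) hcr
    simp only [mul_add, mul_zero, ← mul_assoc, QSphere.mul_self hI, neg_mul, one_mul] at h
    exact (add_neg_eq_zero.mp h).symm
  have hg := (sliceFunctional I a).hasFDerivAt.comp z (hd.comp z (sliceMap I).hasFDerivAt)
  have hL : (ContinuousLinearMap.smulRight (1 : ℂ →L[ℂ] ℂ)
      (sliceFunctional I a (D 1))).restrictScalars ℝ =
      (sliceFunctional I a).comp (D.comp (sliceMap I)) := by
    ext1 w
    simp only [ContinuousLinearMap.coe_restrictScalars', ContinuousLinearMap.smulRight_apply,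
      ContinuousLinearMap.comp_apply, sliceMap_apply, map_add, map_smul, hDI,
      sliceFunctional_mul hI, one_apply_eq_self, smul_eq_mul, Complex.real_smul]
    conv_lhs => rw [← Complex.re_add_im w]
    ring
  exact (hasFDerivAt_of_restrictScalars ℝ hg hL).differentiableAt.differentiableWithinAt

/-- Identity principle on a single slice. -/
lemma SliceRegularOn.eq_zero_on_slice {U : Set ℍ} (hU : SliceDomain U) {f : ℍ → ℍ}
    (hf : SliceRegularOn f U) {I : ℍ} (hI : I ∈ QSphere) {z₀ : ℂ} (hz₀ : sliceMap I z₀ ∈ U)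
    (hfreq : ∃ᶠ z in nhdsWithin z₀ {z₀}ᶜ, f (sliceMap I z) = 0) :
    ∀ q ∈ U ∩ slicePlane I, f q = 0 := by
  have hopen : IsOpen (sliceMap I ⁻¹' U) := hU.1.preimage (sliceMap I).continuous
  have hpre : IsPreconnected (sliceMap I ⁻¹' U) := by
    have himg : sliceMap I ⁻¹' U = sliceCoord I '' (U ∩ slicePlane I) := by
      ext z
      constructor
      · exact fun hz => ⟨_, ⟨hz, sliceMap_mem I z⟩, sliceCoord_sliceMap hI z⟩
      · rintro ⟨q, ⟨hq, hqI⟩, rfl⟩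
        simpa [sliceMap_sliceCoord hI hqI] using hq
    rw [himg]
    exact (hU.2.2.2 I hI).image _ (continuous_sliceCoord I).continuousOn
  rintro q ⟨hq, hqI⟩
  have hzero := ((hf.differentiableOn_comp hU.1 hI (f q)).analyticOnNhd
    hopen).eqOn_zero_of_preconnected_of_frequently_eq_zero hpre hz₀
      (hfreq.mono fun z hz => by simp [hz])
  have h := hzero (show sliceCoord I q ∈ sliceMap I ⁻¹' U by
    simpa [sliceMap_sliceCoord hI hqI] using hq)
  simp only [sliceMap_sliceCoord hI hqI, Pi.zero_apply] at h
  rw [← inner_self_eq_zero (𝕜 := ℝ), ← sliceFunctional_re I, h, Complex.zero_re]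

/-- **Identity Principle.** If `f` is slice regular on a slice domain `U` and its zero
set intersected with some plane `ℂ_I` has an accumulation point in `U ∩ ℂ_I`,
then `f ≡ 0` on `U`. -/
theorem identity_principle (U : Set ℍ) (hU : SliceDomain U) (f : ℍ → ℍ)
    (hf : SliceRegularOn f U)
    (hacc : ∃ I ∈ QSphere, ∃ p ∈ U ∩ slicePlane I,
        AccPt p (Filter.principal (slicePlane I ∩ {q ∈ U | f q = 0}))) :
    ∀ q ∈ U, f q = 0 := by
  obtain ⟨I, hI, p, ⟨hpU, hpI⟩, hp⟩ := hacc
  have hslice : ∀ q ∈ U ∩ slicePlane I, f q = 0 := by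
    refine hf.eq_zero_on_slice hU hI (z₀ := sliceCoord I p)
      (by rwa [sliceMap_sliceCoord hI hpI]) ?_
    rw [frequently_nhdsWithin_iff]
    refine (continuous_sliceCoord I).continuousAt.frequently
      ((accPt_iff_frequently.mp hp).mono ?_)
    rintro q ⟨hne, hqI, -, hq⟩
    refine ⟨by rwa [sliceMap_sliceCoord hI hqI], fun h => hne ?_⟩
    rw [← sliceMap_sliceCoord hI hqI, Set.mem_singleton_iff.mp h, sliceMap_sliceCoord hI hpI]
  obtain ⟨x, hx⟩ := hU.2.2.1
  intro q hq
  obtain ⟨J, hJ, hqJ⟩ := exists_mem_slicePlane hI q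
  refine hf.eq_zero_on_slice hU hJ (z₀ := (x : ℂ)) (by rwa [sliceMap_ofReal]) ?_ q ⟨hq, hqJ⟩
  have hreal : ∃ᶠ t : ℝ in nhdsWithin x {x}ᶜ, f (sliceMap J (t : ℂ)) = 0 := by
    have hev : ∀ᶠ t : ℝ in nhds x, sliceMap I (t : ℂ) ∈ U :=
      ((sliceMap I).continuous.comp Complex.continuous_ofReal).continuousAt.eventually
        (hU.1.mem_nhds (by simpa [sliceMap_ofReal] using hx))
    refine (Filter.Eventually.filter_mono nhdsWithin_le_nhds (hev.mono fun t ht => ?_)).frequently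
    rw [sliceMap_ofReal, ← sliceMap_ofReal I]
    exact hslice _ ⟨ht, sliceMap_mem I _⟩
  rw [frequently_nhdsWithin_iff] at hreal ⊢
  refine Complex.continuous_ofReal.continuousAt.frequently (hreal.mono ?_)
  rintro t ⟨ht, hne⟩
  exact ⟨ht, fun h => hne (Complex.ofReal_injective h)⟩
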